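/- arXiv:math/0009108 — 6 statements merged into one kernel-verified Lean document; each statement's English description precedes it below -/
import Mathlib

section
/- The subgroup of GL(2,ℤ) generated by the two matrices [[1,2],[0,1]] and [[1,0],[2,1]] consists exactly of those matrices A = [[a,b],[c,d]] ∈ GL(2,ℤ) with a ≡ 1 (mod 4), d ≡ 1 (mod 4), b ≡ 0 (mod 2) and c ≡ 0 (mod 2). -/
open Matrix

/-- The lower unitriangular `2 × 2` matrices as an additive character. -/
def lowerLeftHom {R : Type*} [Ring R] : AddChar R (GL (Fin 2) R) where
  toFun x := ⟨!![1, 0; x, 1], !![1, 0; -x, 1], by simp [one_fin_two], by simp [one_fin_two]⟩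
  map_zero_eq_one' := by simp [Units.ext_iff, one_fin_two]
  map_add_eq_mul' a b := by simp [Units.ext_iff]

/-- The subgroup of `GL(2,ℤ)` of matrices `[[a,b],[c,d]]` with `a ≡ d ≡ 1 (mod 4)` and
`b ≡ c ≡ 0 (mod 2)`. -/
def subgroupH4 : Subgroup (GL (Fin 2) ℤ) where
  carrier := {A | A.val 0 0 ≡ 1 [ZMOD 4] ∧ A.val 1 1 ≡ 1 [ZMOD 4] ∧
    A.val 0 1 ≡ 0 [ZMOD 2] ∧ A.val 1 0 ≡ 0 [ZMOD 2]}
  one_mem' := by simp [Int.ModEq]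
  mul_mem' := by
    rintro A B ⟨a1, a2, a3, a4⟩ ⟨b1, b2, b3, b4⟩
    simp only [Set.mem_ofPred_eq, Units.val_mul, mul_apply, Fin.sum_univ_two]
    obtain ⟨p, hp⟩ := Int.modEq_zero_iff_dvd.mp a3
    obtain ⟨q, hq⟩ := Int.modEq_zero_iff_dvd.mp a4
    obtain ⟨r, hr⟩ := Int.modEq_zero_iff_dvd.mp b3
    obtain ⟨t, ht⟩ := Int.modEq_zero_iff_dvd.mp b4
    have h1 := a1.mul b1
    have h2 := a2.mul b2
    rw [hp, hq, hr, ht]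
    simp only [Int.ModEq] at *
    grind
  inv_mem' := by
    rintro A ⟨a1, a2, a3, a4⟩
    have h : A.val * A⁻¹.val = 1 := by rw [← Units.val_mul, mul_inv_cancel, Units.val_one]
    have h00 := congrFun₂ h 0 0
    have h01 := congrFun₂ h 0 1
    have h10 := congrFun₂ h 1 0
    have h11 := congrFun₂ h 1 1
    simp only [mul_apply, Fin.sum_univ_two, one_apply_eq, ne_eq, zero_ne_one, one_ne_zero,
      not_false_eq_true, one_apply_ne] at h00 h01 h10 h11
    simp only [Set.mem_ofPred_eq]
    generalize A⁻¹.val 0 0 = e at *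
    generalize A⁻¹.val 0 1 = f at *
    generalize A⁻¹.val 1 0 = g at *
    generalize A⁻¹.val 1 1 = i at *
    obtain ⟨p, hp⟩ := a1.symm.dvd
    obtain ⟨q, hq⟩ := a2.symm.dvd
    obtain ⟨r, hr⟩ := Int.modEq_zero_iff_dvd.mp a3
    obtain ⟨t, ht⟩ := Int.modEq_zero_iff_dvd.mp a4
    rw [sub_eq_iff_eq_add] at hp hq
    rw [hp, hr] at h00 h01
    rw [hq, ht] at h10 h11
    have hg : g = 2 * (-t * e - 2 * q * g) := by linear_combination h10
    have hf : f = 2 * (-r * i - 2 * p * f) := by linear_combination h01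
    refine ⟨?_, ?_, ?_, ?_⟩
    · refine (Int.modEq_iff_dvd.mpr ⟨p * e + r * (-t * e - 2 * q * g), ?_⟩)
      linear_combination -h00 + 2 * r * hg
    · refine (Int.modEq_iff_dvd.mpr ⟨q * i + t * (-r * i - 2 * p * f), ?_⟩)
      linear_combination -h11 + 2 * t * hf
    · exact Int.modEq_zero_iff_dvd.mpr ⟨_, hf⟩
    · exact Int.modEq_zero_iff_dvd.mpr ⟨_, hg⟩

lemma mem_subgroupH4 {A : GL (Fin 2) ℤ} : A ∈ subgroupH4 ↔
    A.val 0 0 ≡ 1 [ZMOD 4] ∧ A.val 1 1 ≡ 1 [ZMOD 4] ∧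
    A.val 0 1 ≡ 0 [ZMOD 2] ∧ A.val 1 0 ≡ 0 [ZMOD 2] := Iff.rfl

lemma AddChar.map_two_mul_mem {G : Type*} [Group G] (φ : AddChar ℤ G) {H : Subgroup G}
    (h : φ 2 ∈ H) (k : ℤ) : φ (2 * k) ∈ H := by
  rw [mul_comm, ← smul_eq_mul, AddChar.map_zsmul_eq_zpow]
  exact H.zpow_mem h k

lemma Int.exists_natAbs_add_two_mul_lt {x y : ℤ} (hy : y ≠ 0) (h : y.natAbs < x.natAbs) :
    ∃ k : ℤ, (x + 2 * k * y).natAbs < x.natAbs := by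
  by_cases hs : 0 < x ↔ 0 < y
  · exact ⟨-1, by omega⟩
  · exact ⟨1, by omega⟩

lemma subgroupH4_le {H : Subgroup (GL (Fin 2) ℤ)}
    (hU : GeneralLinearGroup.upperRightHom 2 ∈ H) (hL : lowerLeftHom 2 ∈ H) :
    subgroupH4 ≤ H := by
  have hU4 : GeneralLinearGroup.upperRightHom 2 ∈ subgroupH4 := by
    simp [mem_subgroupH4, GeneralLinearGroup.upperRightHom, Int.ModEq]
  have hL4 : lowerLeftHom 2 ∈ subgroupH4 := by
    simp [mem_subgroupH4, lowerLeftHom, Int.ModEq]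
  intro A hA
  induction hn : (A.val 0 0).natAbs + (A.val 1 0).natAbs using Nat.strong_induction_on
    generalizing A with
  | _ n ih =>
  subst hn
  obtain ⟨h1, h2, h3, h4⟩ := mem_subgroupH4.mp hA
  by_cases hc : A.val 1 0 = 0
  · have hdet : IsUnit (A.val 0 0 * A.val 1 1) := by
      have := (isUnit_iff_isUnit_det A.val).mp A.isUnit
      simpa [det_fin_two, hc] using this
    have ha := Int.isUnit_iff.mp (isUnit_of_mul_isUnit_left hdet)
    have hd := Int.isUnit_iff.mp (isUnit_of_mul_isUnit_right hdet)
    have ha : A.val 0 0 = 1 := by simp only [Int.ModEq] at h1; omega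
    have hd : A.val 1 1 = 1 := by simp only [Int.ModEq] at h2; omega
    obtain ⟨k, hk⟩ := Int.modEq_zero_iff_dvd.mp h3
    convert AddChar.map_two_mul_mem _ hU k using 1
    ext i j
    fin_cases i <;> fin_cases j <;> simp [GeneralLinearGroup.upperRightHom, ha, hc, hd, hk]
  · have ha : A.val 0 0 ≠ 0 := by simp only [Int.ModEq] at h1; omega
    have hne : (A.val 0 0).natAbs ≠ (A.val 1 0).natAbs := by
      simp only [Int.ModEq] at h1 h4; omega
    rcases hne.lt_or_gt with h | h
    · obtain ⟨k, hk⟩ := Int.exists_natAbs_add_two_mul_lt ha h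
      rw [← H.mul_mem_cancel_left (AddChar.map_two_mul_mem _ hL k)]
      refine ih _ ?_ (mul_mem (AddChar.map_two_mul_mem _ hL4 k) hA) rfl
      simpa [lowerLeftHom, mul_apply, add_comm] using hk
    · obtain ⟨k, hk⟩ := Int.exists_natAbs_add_two_mul_lt hc h
      rw [← H.mul_mem_cancel_left (AddChar.map_two_mul_mem _ hU k)]
      refine ih _ ?_ (mul_mem (AddChar.map_two_mul_mem _ hU4 k) hA) rfl
      simpa [GeneralLinearGroup.upperRightHom, mul_apply] using hk

/-- The subgroup of `GL(2,ℤ)` generated by `[[1,2],[0,1]]` and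
`[[1,0],[2,1]]` consists exactly of the matrices `[[a,b],[c,d]] ∈ GL(2,ℤ)` with
`a ≡ d ≡ 1 (mod 4)` and `b ≡ c ≡ 0 (mod 2)`. -/
theorem H4_generated_by_two_matrices (A : GL (Fin 2) ℤ) :
    A ∈ Subgroup.closure {B : GL (Fin 2) ℤ |
        (B : Matrix (Fin 2) (Fin 2) ℤ) = !![1, 2; 0, 1] ∨
        (B : Matrix (Fin 2) (Fin 2) ℤ) = !![1, 0; 2, 1]} ↔
      (A : Matrix (Fin 2) (Fin 2) ℤ) 0 0 ≡ 1 [ZMOD 4] ∧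
      (A : Matrix (Fin 2) (Fin 2) ℤ) 1 1 ≡ 1 [ZMOD 4] ∧
      (A : Matrix (Fin 2) (Fin 2) ℤ) 0 1 ≡ 0 [ZMOD 2] ∧
      (A : Matrix (Fin 2) (Fin 2) ℤ) 1 0 ≡ 0 [ZMOD 2] := by
  rw [← mem_subgroupH4]
  constructor
  · refine fun h ↦ (Subgroup.closure_le _).mpr ?_ h
    rintro B (hB | hB) <;> simp [mem_subgroupH4, hB, Int.ModEq]
  · exact fun h ↦ subgroupH4_le (Subgroup.subset_closure (.inl rfl))
      (Subgroup.subset_closure (.inr rfl)) h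
end

section
/- The subgroup of GL(2,ℤ) generated by the four matrices [[1,1],[0,1]], [[-1,0],[0,1]], [[1,0],[0,-1]] and [[1,0],[2,1]] consists exactly of those matrices [[a,b],[c,d]] ∈ GL(2,ℤ) whose lower-left entry c is even. -/
open Matrix

/-- If the lower-left entry of `A` is even, so is that of `A⁻¹`. -/
theorem even_lowerLeft_inv (A : GL (Fin 2) ℤ)
    (h : Even ((A : Matrix (Fin 2) (Fin 2) ℤ) 1 0)) :
    Even (((A⁻¹ : GL (Fin 2) ℤ) : Matrix (Fin 2) (Fin 2) ℤ) 1 0) := by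
  have hmul : (A : Matrix (Fin 2) (Fin 2) ℤ) * ((A⁻¹ : GL (Fin 2) ℤ) : Matrix _ _ ℤ) = 1 :=
    Units.mul_inv A
  have h10 := congrFun (congrFun hmul 1) 0
  have h11 := congrFun (congrFun hmul 1) 1
  simp only [Matrix.mul_apply, Fin.sum_univ_two, Matrix.one_apply_eq] at h10 h11
  rw [Matrix.one_apply_ne (by decide)] at h10
  have e10 := congrArg (fun n : ℤ => Even n) h10
  have e11 := congrArg (fun n : ℤ => Even n) h11
  simp only [Int.even_add, Int.even_mul, h, true_or, true_iff, Int.not_even_one,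
    Even.zero] at e10 e11
  tauto

/-- The subgroup of matrices in `GL(2,ℤ)` with even lower-left entry. -/
def evenLowerLeft : Subgroup (GL (Fin 2) ℤ) where
  carrier := {A | Even ((A : Matrix (Fin 2) (Fin 2) ℤ) 1 0)}
  one_mem' := by simp
  mul_mem' := by
    intro A B hA hB
    simp only [Set.mem_ofPred_eq, Units.val_mul, Matrix.mul_apply, Fin.sum_univ_two] at *
    exact (hA.mul_right _).add (hB.mul_left _)
  inv_mem' := fun {A} hA => even_lowerLeft_inv A hA

/-- The upper unitriangular matrix `[[1,n],[0,1]]`. -/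
def upperShear (n : ℤ) : GL (Fin 2) ℤ where
  val := !![1, n; 0, 1]
  inv := !![1, -n; 0, 1]
  val_inv := by simp [Matrix.one_fin_two]
  inv_val := by simp [Matrix.one_fin_two]

/-- The lower unitriangular matrix `[[1,0],[n,1]]`. -/
def lowerShear (n : ℤ) : GL (Fin 2) ℤ where
  val := !![1, 0; n, 1]
  inv := !![1, 0; -n, 1]
  val_inv := by simp [Matrix.one_fin_two]
  inv_val := by simp [Matrix.one_fin_two]

/-- The diagonal matrix with entries the units `u` and `v`. -/
def diagUnits (u v : ℤˣ) : GL (Fin 2) ℤ where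
  val := !![(u : ℤ), 0; 0, (v : ℤ)]
  inv := !![(u : ℤ), 0; 0, (v : ℤ)]
  val_inv := by simp [Matrix.one_fin_two, ← Units.val_mul]
  inv_val := by simp [Matrix.one_fin_two, ← Units.val_mul]

theorem upperShear_mem {K : Subgroup (GL (Fin 2) ℤ)} (h : upperShear 1 ∈ K) (n : ℤ) :
    upperShear n ∈ K := by
  have hadd (m k : ℤ) : upperShear (m + k) = upperShear m * upperShear k := by
    apply Units.ext
    simp [upperShear, add_comm]
  induction n with
  | zero =>
    have : upperShear 0 = 1 := by
      apply Units.ext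
      simp [upperShear, Matrix.one_fin_two]
    exact this ▸ K.one_mem
  | succ i ih => exact hadd _ _ ▸ K.mul_mem ih h
  | pred i ih =>
    have : upperShear (-i : ℤ) = upperShear (-i - 1) * upperShear 1 := by
      rw [← hadd, sub_add_cancel]
    rw [this] at ih
    exact (K.mul_mem_cancel_right h).1 ih

theorem diagUnits_mem {K : Subgroup (GL (Fin 2) ℤ)} (h₁ : diagUnits (-1) 1 ∈ K)
    (h₂ : diagUnits 1 (-1) ∈ K) (u v : ℤˣ) : diagUnits u v ∈ K := by
  have hmul : diagUnits u v = diagUnits u 1 * diagUnits 1 v := by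
    apply Units.ext
    simp [diagUnits]
  have hone : diagUnits 1 1 = 1 := by
    apply Units.ext
    simp [diagUnits, Matrix.one_fin_two]
  rw [hmul]
  rcases Int.units_eq_one_or u with rfl | rfl <;> rcases Int.units_eq_one_or v with rfl | rfl <;>
    simp [hone, h₁, h₂, K.mul_mem]

/-- Upper triangular matrices are products of a diagonal matrix and a shear. -/
theorem mem_of_lowerLeft_eq_zero {K : Subgroup (GL (Fin 2) ℤ)} (hT : upperShear 1 ∈ K)
    (h₁ : diagUnits (-1) 1 ∈ K) (h₂ : diagUnits 1 (-1) ∈ K) (A : GL (Fin 2) ℤ)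
    (hA : (A : Matrix (Fin 2) (Fin 2) ℤ) 1 0 = 0) : A ∈ K := by
  have hdet : IsUnit (A : Matrix (Fin 2) (Fin 2) ℤ).det :=
    (Matrix.isUnit_iff_isUnit_det _).1 A.isUnit
  rw [Matrix.det_fin_two, hA, mul_zero, sub_zero, IsUnit.mul_iff] at hdet
  obtain ⟨⟨u, hu⟩, ⟨v, hv⟩⟩ := hdet
  have : A = diagUnits u v * upperShear (u * (A : Matrix (Fin 2) (Fin 2) ℤ) 0 1) := by
    apply Units.ext
    rw [Matrix.eta_fin_two (A : Matrix (Fin 2) (Fin 2) ℤ), hA, ← hu, ← hv]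
    simp [diagUnits, upperShear, ← mul_assoc, ← Units.val_mul]
  rw [this]
  exact K.mul_mem (diagUnits_mem h₁ h₂ u v) (upperShear_mem hT _)

/-- Euclidean descent on the first column. -/
theorem mem_of_even_lowerLeft {K : Subgroup (GL (Fin 2) ℤ)} (hT : upperShear 1 ∈ K)
    (h₁ : diagUnits (-1) 1 ∈ K) (h₂ : diagUnits 1 (-1) ∈ K) (hU : lowerShear 2 ∈ K)
    (A : GL (Fin 2) ℤ) (hA : Even ((A : Matrix (Fin 2) (Fin 2) ℤ) 1 0)) : A ∈ K := by
  induction hn : ((A : Matrix (Fin 2) (Fin 2) ℤ) 0 0).natAbs +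
    ((A : Matrix (Fin 2) (Fin 2) ℤ) 1 0).natAbs using Nat.strong_induction_on generalizing A with
  | _ n ih =>
  subst hn
  have hodd : Odd ((A : Matrix (Fin 2) (Fin 2) ℤ) 0 0) := by
    have hdet : IsUnit (A : Matrix (Fin 2) (Fin 2) ℤ).det :=
      (Matrix.isUnit_iff_isUnit_det _).1 A.isUnit
    have hdet_odd : Odd (A : Matrix (Fin 2) (Fin 2) ℤ).det := by
      rcases Int.isUnit_iff.1 hdet with h | h <;> rw [h] <;> decide
    rw [Matrix.det_fin_two, Int.odd_sub, iff_true_right (hA.mul_left _)] at hdet_odd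
    exact (Int.odd_mul.1 hdet_odd).1
  by_cases hc : (A : Matrix (Fin 2) (Fin 2) ℤ) 1 0 = 0
  · exact mem_of_lowerLeft_eq_zero hT h₁ h₂ A hc
  have descend (g : GL (Fin 2) ℤ) (hg : g ∈ K)
      (he : Even (((g * A : GL (Fin 2) ℤ) : Matrix (Fin 2) (Fin 2) ℤ) 1 0))
      (hlt : (((g * A : GL (Fin 2) ℤ) : Matrix (Fin 2) (Fin 2) ℤ) 0 0).natAbs +
        (((g * A : GL (Fin 2) ℤ) : Matrix (Fin 2) (Fin 2) ℤ) 1 0).natAbs <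
        ((A : Matrix (Fin 2) (Fin 2) ℤ) 0 0).natAbs +
        ((A : Matrix (Fin 2) (Fin 2) ℤ) 1 0).natAbs) : A ∈ K :=
    (K.mul_mem_cancel_left hg).1 (ih _ hlt _ he rfl)
  have dT := descend _ hT
  have dT' := descend _ (K.inv_mem hT)
  have dU := descend _ hU
  have dU' := descend _ (K.inv_mem hU)
  have invT : (((upperShear 1)⁻¹ : GL (Fin 2) ℤ) : Matrix (Fin 2) (Fin 2) ℤ) =
    !![1, -1; 0, 1] := rfl
  have invU : (((lowerShear 2)⁻¹ : GL (Fin 2) ℤ) : Matrix (Fin 2) (Fin 2) ℤ) =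
    !![1, 0; -2, 1] := rfl
  simp only [Units.val_mul, invT, invU, Matrix.mul_apply, Fin.sum_univ_two] at dT dT' dU dU'
  simp [upperShear, lowerShear] at dT dT' dU dU'
  generalize (A : Matrix (Fin 2) (Fin 2) ℤ) 0 0 = a at *
  generalize (A : Matrix (Fin 2) (Fin 2) ℤ) 1 0 = c at *
  rw [Int.even_iff] at *
  rw [Int.odd_iff] at hodd
  clear descend ih
  by_contra hmem
  simp only [hmem, imp_false] at dT dT' dU dU'
  omega

/-- The subgroup of `GL(2,ℤ)` generated by `[[1,1],[0,1]]`,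
`[[-1,0],[0,1]]`, `[[1,0],[0,-1]]` and `[[1,0],[2,1]]` consists exactly of those
matrices in `GL(2,ℤ)` whose lower-left entry is even. -/
theorem H1_generated_by_four_matrices (A : GL (Fin 2) ℤ) :
    A ∈ Subgroup.closure {B : GL (Fin 2) ℤ |
        (B : Matrix (Fin 2) (Fin 2) ℤ) = !![1, 1; 0, 1] ∨
        (B : Matrix (Fin 2) (Fin 2) ℤ) = !![-1, 0; 0, 1] ∨
        (B : Matrix (Fin 2) (Fin 2) ℤ) = !![1, 0; 0, -1] ∨
        (B : Matrix (Fin 2) (Fin 2) ℤ) = !![1, 0; 2, 1]} ↔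
      Even ((A : Matrix (Fin 2) (Fin 2) ℤ) 1 0) := by
  constructor
  · intro h
    refine (Subgroup.closure_le evenLowerLeft).2 ?_ h
    rintro B (hB | hB | hB | hB) <;> simp [evenLowerLeft, hB]
  · refine mem_of_even_lowerLeft ?_ ?_ ?_ ?_ A <;> apply Subgroup.subset_closure
    · exact Or.inl rfl
    · exact Or.inr (Or.inl (by simp [diagUnits]))
    · exact Or.inr (Or.inr (Or.inl (by simp [diagUnits])))
    · exact Or.inr (Or.inr (Or.inr rfl))
end

section
/- For every matrix A ∈ GL(2,ℤ) there exist a unique matrix B ∈ GL(2,ℤ) congruent to the identity matrix modulo 2 (entrywise) and a unique matrix C in the subgroup K₆ generated by [[0,1],[-1,-1]] and [[0,1],[1,0]], such that A = B·C. (That is, GL(2,ℤ) is the semidirect product of the mod-2 congruence subgroup H₂ by K₆.) -/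
open Matrix

/-- The subgroup `K₆` of `GL(2,ℤ)` generated by `[[0,1],[-1,-1]]` and `[[0,1],[1,0]]`. -/
def K₆ : Subgroup (GL (Fin 2) ℤ) :=
  Subgroup.closure {B : GL (Fin 2) ℤ |
    (B : Matrix (Fin 2) (Fin 2) ℤ) = !![0, 1; -1, -1] ∨
    (B : Matrix (Fin 2) (Fin 2) ℤ) = !![0, 1; 1, 0]}

/-- The six matrices that make up `K₆`. -/
def K₆Matrices : List (Matrix (Fin 2) (Fin 2) ℤ) :=
  [1, !![0, 1; -1, -1], !![-1, -1; 1, 0], !![0, 1; 1, 0], !![1, 0; -1, -1], !![-1, -1; 0, 1]]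

theorem K₆Matrices_mul_mem :
    ∀ M ∈ K₆Matrices, ∀ N ∈ K₆Matrices, M * N ∈ K₆Matrices := by
  decide

theorem K₆Matrices_exists_mul_eq_one :
    ∀ M ∈ K₆Matrices, ∃ N ∈ K₆Matrices, M * N = 1 := by
  decide

theorem K₆Matrices_eq_one :
    ∀ M ∈ K₆Matrices, M.map (Int.castRingHom (ZMod 2)) = 1 → M = 1 := by
  decide

theorem exists_K₆Matrices_map_eq :
    ∀ X : Matrix (Fin 2) (Fin 2) (ZMod 2), X.det ≠ 0 →
      ∃ M ∈ K₆Matrices, M.map (Int.castRingHom (ZMod 2)) = X := by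
  intro X hX
  have key : ∀ a b c d : ZMod 2, a * d - b * c ≠ 0 →
      ∃ M ∈ K₆Matrices, M.map (Int.castRingHom (ZMod 2)) = !![a, b; c, d] := by
    decide
  rw [eta_fin_two X]
  exact key _ _ _ _ (by rwa [← det_fin_two])

theorem mem_K₆Matrices_of_mem_K₆ {C : GL (Fin 2) ℤ} (hC : C ∈ K₆) :
    (C : Matrix (Fin 2) (Fin 2) ℤ) ∈ K₆Matrices := by
  induction hC using Subgroup.closure_induction with
  | mem x hx => rcases hx with h | h <;> simp [h, K₆Matrices]
  | one => simp [K₆Matrices]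
  | mul x y _ _ hx hy => exact K₆Matrices_mul_mem _ hx _ hy
  | inv x _ hx =>
    obtain ⟨N, hN, h⟩ := K₆Matrices_exists_mul_eq_one _ hx
    rwa [Units.inv_eq_of_mul_eq_one_right h]

theorem exists_mem_K₆_of_mem_K₆Matrices {M : Matrix (Fin 2) (Fin 2) ℤ} (hM : M ∈ K₆Matrices) :
    ∃ C ∈ K₆, (C : Matrix (Fin 2) (Fin 2) ℤ) = M := by
  let R : GL (Fin 2) ℤ := ⟨!![0, 1; -1, -1], !![-1, -1; 1, 0], by decide, by decide⟩
  let S : GL (Fin 2) ℤ := ⟨!![0, 1; 1, 0], !![0, 1; 1, 0], by decide, by decide⟩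
  have hR : R ∈ K₆ := Subgroup.subset_closure (Or.inl rfl)
  have hS : S ∈ K₆ := Subgroup.subset_closure (Or.inr rfl)
  simp only [K₆Matrices, List.mem_cons, List.not_mem_nil, or_false] at hM
  rcases hM with rfl | rfl | rfl | rfl | rfl | rfl
  · exact ⟨1, one_mem _, rfl⟩
  · exact ⟨R, hR, rfl⟩
  · exact ⟨R⁻¹, inv_mem hR, rfl⟩
  · exact ⟨S, hS, rfl⟩
  · exact ⟨R * S, mul_mem hR hS, by decide⟩
  · exact ⟨R⁻¹ * S, mul_mem (inv_mem hR) hS, by decide⟩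

/-- Reduction modulo 2 on `GL(2,ℤ)`. -/
abbrev reduceModTwo : GL (Fin 2) ℤ →* GL (Fin 2) (ZMod 2) :=
  GeneralLinearGroup.map (Int.castRingHom (ZMod 2))

theorem reduceModTwo_eq_one_iff (B : GL (Fin 2) ℤ) :
    reduceModTwo B = 1 ↔ ∀ i j, (B : Matrix (Fin 2) (Fin 2) ℤ) i j ≡
      (1 : Matrix (Fin 2) (Fin 2) ℤ) i j [ZMOD 2] := by
  rw [Units.ext_iff, ← Matrix.ext_iff]
  refine forall₂_congr fun i j => ?_
  have h := ZMod.intCast_eq_intCast_iff (B i j) ((1 : Matrix (Fin 2) (Fin 2) ℤ) i j) 2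
  rw [Nat.cast_ofNat] at h
  rw [← h]
  simp [Matrix.one_apply]

theorem eq_one_of_mem_K₆_of_reduceModTwo_eq_one {C : GL (Fin 2) ℤ} (hC : C ∈ K₆)
    (h : reduceModTwo C = 1) : C = 1 :=
  Units.ext (K₆Matrices_eq_one _ (mem_K₆Matrices_of_mem_K₆ hC) (congrArg Units.val h))

theorem exists_mem_K₆_reduceModTwo_eq (X : GL (Fin 2) (ZMod 2)) :
    ∃ C ∈ K₆, reduceModTwo C = X := by
  obtain ⟨M, hM, h⟩ := exists_K₆Matrices_map_eq X.val (GeneralLinearGroup.det X).ne_zero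
  obtain ⟨C, hC, rfl⟩ := exists_mem_K₆_of_mem_K₆Matrices hM
  exact ⟨C, hC, Units.ext h⟩

/-- Every `A ∈ GL(2,ℤ)` factors uniquely as `A = B * C` with
`B ≡ 1 (mod 2)` entrywise and `C ∈ K₆`; i.e. `GL(2,ℤ)` is the semidirect
product of the mod-2 congruence subgroup `H₂` by `K₆`. -/
theorem GL2Z_semidirect_H2_K6 (A : GL (Fin 2) ℤ) :
    ∃! BC : GL (Fin 2) ℤ × GL (Fin 2) ℤ,
      (∀ i j, (BC.1 : Matrix (Fin 2) (Fin 2) ℤ) i j ≡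
          (1 : Matrix (Fin 2) (Fin 2) ℤ) i j [ZMOD 2]) ∧
      BC.2 ∈ K₆ ∧ A = BC.1 * BC.2 := by
  simp_rw [← reduceModTwo_eq_one_iff]
  obtain ⟨C, hC, hCA⟩ := exists_mem_K₆_reduceModTwo_eq (reduceModTwo A)
  refine ⟨(A * C⁻¹, C), ⟨by rw [map_mul, map_inv, hCA, mul_inv_cancel], hC, by simp⟩, ?_⟩
  rintro ⟨D, E⟩ ⟨hD, hE, rfl⟩
  have h : E * C⁻¹ = 1 := by
    refine eq_one_of_mem_K₆_of_reduceModTwo_eq_one (mul_mem hE (inv_mem hC)) ?_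
    rw [map_mul, map_inv, hCA, map_mul, hD, one_mul, mul_inv_cancel]
  obtain rfl := mul_inv_eq_one.mp h
  simp
end

section
/- For every matrix A ∈ GL(2,ℤ) congruent to the identity matrix modulo 2 (entrywise) there exist a unique matrix B ∈ GL(2,ℤ) with diagonal entries ≡ 1 (mod 4) and off-diagonal entries ≡ 0 (mod 2), and a unique diagonal matrix C = diag(ε₁,ε₂) with ε₁,ε₂ ∈ {1,-1}, such that A = B·C. (That is, H₂ is the semidirect product of H₄ by K₄.) -/
open Matrix

/-- An odd integer has a sign multiple congruent to `1` modulo `4`. -/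
theorem Int.exists_sign_mul_modEq_one {a : ℤ} (ha : a ≡ 1 [ZMOD 2]) :
    ∃ ε : ℤ, (ε = 1 ∨ ε = -1) ∧ a * ε ≡ 1 [ZMOD 4] := by
  simp only [Int.ModEq] at ha ⊢
  obtain h | h : a % 4 = 1 ∨ a % 4 = 3 := by omega
  · exact ⟨1, .inl rfl, by omega⟩
  · exact ⟨-1, .inr rfl, by omega⟩

/-- The sign relating an integer to one congruent to `1` modulo `4` is unique. -/
theorem Int.sign_unique_of_modEq_one {b b' ε ε' : ℤ} (hb : b ≡ 1 [ZMOD 4])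
    (hb' : b' ≡ 1 [ZMOD 4]) (hε : ε = 1 ∨ ε = -1) (hε' : ε' = 1 ∨ ε' = -1)
    (h : b * ε = b' * ε') : ε = ε' := by
  simp only [Int.ModEq] at hb hb'
  rcases hε with rfl | rfl <;> rcases hε' with rfl | rfl <;> omega

/-- The diagonal matrix with entries `ε₁`, `ε₂` of square one, as its own inverse. -/
def signDiagonal (ε₁ ε₂ : ℤ) (h₁ : ε₁ * ε₁ = 1) (h₂ : ε₂ * ε₂ = 1) : GL (Fin 2) ℤ where
  val := !![ε₁, 0; 0, ε₂]
  inv := !![ε₁, 0; 0, ε₂]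
  val_inv := by simp [Matrix.one_fin_two, h₁, h₂]
  inv_val := by simp [Matrix.one_fin_two, h₁, h₂]

/-- Every `A ∈ GL(2,ℤ)` congruent to the identity modulo 2 factors
uniquely as `A = B * C` where `B ∈ GL(2,ℤ)` has diagonal entries `≡ 1 (mod 4)`
and off-diagonal entries `≡ 0 (mod 2)`, and `C = diag(ε₁, ε₂)` with
`ε₁, ε₂ ∈ {1, -1}`; i.e. `H₂` is the semidirect product of `H₄` by `K₄`. -/
theorem H2_semidirect_H4_K4 (A : GL (Fin 2) ℤ)
    (hA : ∀ i j, (A : Matrix (Fin 2) (Fin 2) ℤ) i j ≡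
        (1 : Matrix (Fin 2) (Fin 2) ℤ) i j [ZMOD 2]) :
    ∃! BC : GL (Fin 2) ℤ × GL (Fin 2) ℤ,
      ((BC.1 : Matrix (Fin 2) (Fin 2) ℤ) 0 0 ≡ 1 [ZMOD 4] ∧
       (BC.1 : Matrix (Fin 2) (Fin 2) ℤ) 1 1 ≡ 1 [ZMOD 4] ∧
       (BC.1 : Matrix (Fin 2) (Fin 2) ℤ) 0 1 ≡ 0 [ZMOD 2] ∧
       (BC.1 : Matrix (Fin 2) (Fin 2) ℤ) 1 0 ≡ 0 [ZMOD 2]) ∧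
      (∃ ε₁ ε₂ : ℤ, (ε₁ = 1 ∨ ε₁ = -1) ∧ (ε₂ = 1 ∨ ε₂ = -1) ∧
        (BC.2 : Matrix (Fin 2) (Fin 2) ℤ) = !![ε₁, 0; 0, ε₂]) ∧
      A = BC.1 * BC.2 := by
  have sq {ε : ℤ} (h : ε = 1 ∨ ε = -1) : ε * ε = 1 := by rcases h with rfl | rfl <;> rfl
  obtain ⟨ε₁, hε₁, h₁⟩ := Int.exists_sign_mul_modEq_one (by simpa using hA 0 0)
  obtain ⟨ε₂, hε₂, h₂⟩ := Int.exists_sign_mul_modEq_one (by simpa using hA 1 1)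
  have h01 : (A : Matrix (Fin 2) (Fin 2) ℤ) 0 1 ≡ 0 [ZMOD 2] := by simpa using hA 0 1
  have h10 : (A : Matrix (Fin 2) (Fin 2) ℤ) 1 0 ≡ 0 [ZMOD 2] := by simpa using hA 1 0
  set C := signDiagonal ε₁ ε₂ (sq hε₁) (sq hε₂)
  have hCC : C * C = 1 := C.val_inv |> Units.ext
  have hCval : (C : Matrix (Fin 2) (Fin 2) ℤ) = !![ε₁, 0; 0, ε₂] := rfl
  refine ⟨(A * C, C), ⟨⟨?_, ?_, ?_, ?_⟩, ⟨ε₁, ε₂, hε₁, hε₂, hCval⟩, ?_⟩, ?_⟩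
  · simpa [hCval, Matrix.mul_apply, Fin.sum_univ_two] using h₁
  · simpa [hCval, Matrix.mul_apply, Fin.sum_univ_two] using h₂
  · simpa [hCval, Matrix.mul_apply, Fin.sum_univ_two] using h01.mul_right ε₂
  · simpa [hCval, Matrix.mul_apply, Fin.sum_univ_two] using h10.mul_right ε₁
  · rw [mul_assoc, hCC, mul_one]
  · rintro ⟨B', C'⟩ ⟨⟨h₁', h₂', -, -⟩, ⟨ε₁', ε₂', hε₁', hε₂', hC'⟩, hA'⟩
    dsimp only at h₁' h₂' hC' hA'
    have e₁ : (A : Matrix (Fin 2) (Fin 2) ℤ) 0 0 = B'.val 0 0 * ε₁' := by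
      simp [hA', hC', Matrix.mul_apply, Fin.sum_univ_two]
    have e₂ : (A : Matrix (Fin 2) (Fin 2) ℤ) 1 1 = B'.val 1 1 * ε₂' := by
      simp [hA', hC', Matrix.mul_apply, Fin.sum_univ_two]
    have d₁ : ε₁ = ε₁' := Int.sign_unique_of_modEq_one h₁ h₁' hε₁ hε₁'
      (by rw [mul_assoc, sq hε₁, mul_one, e₁])
    have d₂ : ε₂ = ε₂' := Int.sign_unique_of_modEq_one h₂ h₂' hε₂ hε₂'
      (by rw [mul_assoc, sq hε₂, mul_one, e₂])
    have hCC' : C' = C := Units.ext (by rw [hC', hCval, d₁, d₂])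
    rw [hA', hCC', mul_assoc, hCC, mul_one]
end

section
/- The subgroup of GL(2,ℤ) generated by the six matrices [[-1,0],[0,1]], [[-1,2],[0,1]], [[-1,-2],[0,1]], [[1,0],[0,-1]], [[1,0],[2,1]] and [[1,0],[-2,1]] is exactly H₂, the set of matrices in GL(2,ℤ) congruent to the identity matrix modulo 2 (entrywise). -/
open Matrix

/-- The transvection `[[1, 2], [0, 1]]` in `GL(2,ℤ)`. -/
def upperTwo : GL (Fin 2) ℤ :=
  ⟨!![1, 2; 0, 1], !![1, -2; 0, 1], by decide, by decide⟩

/-- The transvection `[[1, 0], [2, 1]]` in `GL(2,ℤ)`. -/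
def lowerTwo : GL (Fin 2) ℤ :=
  ⟨!![1, 0; 2, 1], !![1, 0; -2, 1], by decide, by decide⟩

/-- The reflection `[[-1, 0], [0, 1]]` in `GL(2,ℤ)`. -/
def reflFst : GL (Fin 2) ℤ :=
  ⟨!![-1, 0; 0, 1], !![-1, 0; 0, 1], by decide, by decide⟩

/-- The reflection `[[1, 0], [0, -1]]` in `GL(2,ℤ)`. -/
def reflSnd : GL (Fin 2) ℤ :=
  ⟨!![1, 0; 0, -1], !![1, 0; 0, -1], by decide, by decide⟩

theorem coe_upperTwo_mul (A : GL (Fin 2) ℤ) :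
    (upperTwo * A).val = !![A 0 0 + 2 * A 1 0, A 0 1 + 2 * A 1 1; A 1 0, A 1 1] := by
  ext i j; fin_cases i <;> fin_cases j <;> simp [upperTwo, Matrix.mul_apply, Fin.sum_univ_two]

theorem coe_upperTwo_inv_mul (A : GL (Fin 2) ℤ) :
    (upperTwo⁻¹ * A).val = !![A 0 0 - 2 * A 1 0, A 0 1 - 2 * A 1 1; A 1 0, A 1 1] := by
  have h : (upperTwo⁻¹).val = !![1, -2; 0, 1] := rfl
  rw [Units.val_mul, h]
  ext i j; fin_cases i <;> fin_cases j <;>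
    simp [Matrix.mul_apply, Fin.sum_univ_two] <;> ring

theorem coe_lowerTwo_mul (A : GL (Fin 2) ℤ) :
    (lowerTwo * A).val = !![A 0 0, A 0 1; A 1 0 + 2 * A 0 0, A 1 1 + 2 * A 0 1] := by
  ext i j; fin_cases i <;> fin_cases j <;>
    simp [lowerTwo, Matrix.mul_apply, Fin.sum_univ_two] <;> ring

theorem coe_lowerTwo_inv_mul (A : GL (Fin 2) ℤ) :
    (lowerTwo⁻¹ * A).val = !![A 0 0, A 0 1; A 1 0 - 2 * A 0 0, A 1 1 - 2 * A 0 1] := by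
  have h : (lowerTwo⁻¹).val = !![1, 0; -2, 1] := rfl
  rw [Units.val_mul, h]
  ext i j; fin_cases i <;> fin_cases j <;>
    simp [Matrix.mul_apply, Fin.sum_univ_two] <;> ring

theorem det_eq_one_or_neg_one (A : GL (Fin 2) ℤ) :
    A 0 0 * A 1 1 - A 0 1 * A 1 0 = 1 ∨ A 0 0 * A 1 1 - A 0 1 * A 1 0 = -1 := by
  rw [← Matrix.det_fin_two, ← Int.isUnit_iff]
  exact (Matrix.isUnit_iff_isUnit_det _).1 A.isUnit

theorem mem_of_lower_left_eq_zero {K : Subgroup (GL (Fin 2) ℤ)} (hU : upperTwo ∈ K)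
    (hP : reflFst ∈ K) (hQ : reflSnd ∈ K) (n : ℕ) (A : GL (Fin 2) ℤ)
    (hn : (A 0 1).natAbs = n) (hc : A 1 0 = 0) (hb : A 0 1 % 2 = 0) : A ∈ K := by
  induction n using Nat.strong_induction_on generalizing A with
  | _ n ih =>
  have hdet := det_eq_one_or_neg_one A
  rw [hc, mul_zero, sub_zero] at hdet
  have ha : A 0 0 = 1 ∨ A 0 0 = -1 :=
    Int.isUnit_iff.1 (isUnit_of_mul_isUnit_left (Int.isUnit_iff.2 hdet))
  have hd : A 1 1 = 1 ∨ A 1 1 = -1 :=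
    Int.isUnit_iff.1 (isUnit_of_mul_isUnit_right (Int.isUnit_iff.2 hdet))
  by_cases hb0 : A 0 1 = 0
  · have hA := Matrix.eta_fin_two A.val
    rw [hc, hb0] at hA
    rcases ha with ha | ha <;> rcases hd with hd | hd <;> rw [ha, hd] at hA
    · have : A = 1 := Units.ext (hA.trans (by decide))
      exact this ▸ K.one_mem
    · have : A = reflSnd := Units.ext hA
      exact this ▸ hQ
    · have : A = reflFst := Units.ext hA
      exact this ▸ hP
    · have : A = reflFst * reflSnd := Units.ext (hA.trans (by decide))
      exact this ▸ K.mul_mem hP hQ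
  · rcases (by omega : (A 0 1 + 2 * A 1 1).natAbs < n ∨ (A 0 1 - 2 * A 1 1).natAbs < n) with h | h
    · refine (K.mul_mem_cancel_left hU).1 (ih _ h _ ?_ ?_ ?_) <;>
        simp only [coe_upperTwo_mul, of_apply, cons_val] <;> omega
    · refine (K.mul_mem_cancel_left (K.inv_mem hU)).1 (ih _ h _ ?_ ?_ ?_) <;>
        simp only [coe_upperTwo_inv_mul, of_apply, cons_val] <;> omega

theorem mem_of_congr_one_mod_two {K : Subgroup (GL (Fin 2) ℤ)} (hU : upperTwo ∈ K)
    (hL : lowerTwo ∈ K) (hP : reflFst ∈ K) (hQ : reflSnd ∈ K) (n : ℕ) (A : GL (Fin 2) ℤ)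
    (hn : (A 0 0).natAbs + (A 1 0).natAbs = n) (ha : A 0 0 % 2 = 1) (hb : A 0 1 % 2 = 0)
    (hc : A 1 0 % 2 = 0) : A ∈ K := by
  induction n using Nat.strong_induction_on generalizing A with
  | _ n ih =>
  by_cases hc0 : A 1 0 = 0
  · exact mem_of_lower_left_eq_zero hU hP hQ _ A rfl hc0 hb
  · rcases (by omega : (A 0 0 + 2 * A 1 0).natAbs < (A 0 0).natAbs ∨
        (A 0 0 - 2 * A 1 0).natAbs < (A 0 0).natAbs ∨
        (A 1 0 + 2 * A 0 0).natAbs < (A 1 0).natAbs ∨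
        (A 1 0 - 2 * A 0 0).natAbs < (A 1 0).natAbs) with h | h | h | h
    · refine (K.mul_mem_cancel_left hU).1
        (ih ((A 0 0 + 2 * A 1 0).natAbs + (A 1 0).natAbs) (by omega) _ ?_ ?_ ?_ ?_) <;>
        simp only [coe_upperTwo_mul, of_apply, cons_val] <;> omega
    · refine (K.mul_mem_cancel_left (K.inv_mem hU)).1
        (ih ((A 0 0 - 2 * A 1 0).natAbs + (A 1 0).natAbs) (by omega) _ ?_ ?_ ?_ ?_) <;>
        simp only [coe_upperTwo_inv_mul, of_apply, cons_val] <;> omega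
    · refine (K.mul_mem_cancel_left hL).1
        (ih ((A 0 0).natAbs + (A 1 0 + 2 * A 0 0).natAbs) (by omega) _ ?_ ?_ ?_ ?_) <;>
        simp only [coe_lowerTwo_mul, of_apply, cons_val] <;> omega
    · refine (K.mul_mem_cancel_left (K.inv_mem hL)).1
        (ih ((A 0 0).natAbs + (A 1 0 - 2 * A 0 0).natAbs) (by omega) _ ?_ ?_ ?_ ?_) <;>
        simp only [coe_lowerTwo_inv_mul, of_apply, cons_val] <;> omega

theorem mem_ker_map_castRingHom_iff (n : ℕ) (A : GL (Fin 2) ℤ) :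
    A ∈ (Matrix.GeneralLinearGroup.map (n := Fin 2) (Int.castRingHom (ZMod n))).ker ↔
      ∀ i j, A i j ≡ (1 : Matrix (Fin 2) (Fin 2) ℤ) i j [ZMOD n] := by
  rw [MonoidHom.mem_ker, Matrix.GeneralLinearGroup.ext_iff]
  refine forall₂_congr fun i j => ?_
  rw [← ZMod.intCast_eq_intCast_iff, Matrix.GeneralLinearGroup.map_apply, eq_intCast,
    Units.val_one, Matrix.one_apply, Matrix.one_apply]
  split_ifs <;> simp

/-- The subgroup of `GL(2,ℤ)` generated by the six matrices
`[[-1,0],[0,1]]`, `[[-1,2],[0,1]]`, `[[-1,-2],[0,1]]`, `[[1,0],[0,-1]]`,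
`[[1,0],[2,1]]` and `[[1,0],[-2,1]]` is exactly `H₂`, the set of matrices in
`GL(2,ℤ)` congruent to the identity matrix modulo 2 entrywise. -/
theorem H2_generated_by_six_matrices (A : GL (Fin 2) ℤ) :
    A ∈ Subgroup.closure {B : GL (Fin 2) ℤ |
        (B : Matrix (Fin 2) (Fin 2) ℤ) = !![-1, 0; 0, 1] ∨
        (B : Matrix (Fin 2) (Fin 2) ℤ) = !![-1, 2; 0, 1] ∨
        (B : Matrix (Fin 2) (Fin 2) ℤ) = !![-1, -2; 0, 1] ∨
        (B : Matrix (Fin 2) (Fin 2) ℤ) = !![1, 0; 0, -1] ∨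
        (B : Matrix (Fin 2) (Fin 2) ℤ) = !![1, 0; 2, 1] ∨
        (B : Matrix (Fin 2) (Fin 2) ℤ) = !![1, 0; -2, 1]} ↔
      ∀ i j, (A : Matrix (Fin 2) (Fin 2) ℤ) i j ≡
        (1 : Matrix (Fin 2) (Fin 2) ℤ) i j [ZMOD 2] := by
  constructor
  · intro hA
    refine (mem_ker_map_castRingHom_iff 2 A).1 ((Subgroup.closure_le _).2 ?_ hA)
    intro B hB
    refine (mem_ker_map_castRingHom_iff 2 B).2 ?_
    rcases hB with h | h | h | h | h | h <;> rw [h] <;>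
      simp only [Int.ModEq] <;> decide
  · intro h
    refine mem_of_congr_one_mod_two ?_ ?_ ?_ ?_ _ A rfl (h 0 0) (h 0 1) (h 1 0)
    · let V : GL (Fin 2) ℤ := ⟨!![-1, 2; 0, 1], !![-1, 2; 0, 1], by decide, by decide⟩
      have hV : upperTwo = V * reflFst := Units.ext (by decide)
      rw [hV]
      exact Subgroup.mul_mem _ (Subgroup.subset_closure (Or.inr (Or.inl rfl)))
        (Subgroup.subset_closure (Or.inl rfl))
    · exact Subgroup.subset_closure (by simp [lowerTwo])
    · exact Subgroup.subset_closure (Or.inl rfl)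
    · exact Subgroup.subset_closure (by simp [reflSnd])
end

section
/- For every real number c, the set of real numbers z satisfying z³ − 4z = c·(z² − 1) has exactly three elements, and none of these solutions satisfies z² = 1. (That is, the map z ↦ (z³ − 4z)/(z² − 1) from ℝℙ¹ to ℝℙ¹ is three-to-one over every finite real value.) -/
/-- The cubic equation `x³ - 4x = c (x² - 1)` has at most three real solutions. -/
lemma eq_or_eq_or_eq_of_solutions {c u v w z : ℝ}
    (huv : u ≠ v) (huw : u ≠ w) (hvw : v ≠ w)
    (hu : u ^ 3 - 4 * u = c * (u ^ 2 - 1)) (hv : v ^ 3 - 4 * v = c * (v ^ 2 - 1))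
    (hw : w ^ 3 - 4 * w = c * (w ^ 2 - 1)) (hz : z ^ 3 - 4 * z = c * (z ^ 2 - 1)) :
    z = u ∨ z = v ∨ z = w := by
  have quad : ∀ x : ℝ, x ≠ u → x ^ 3 - 4 * x = c * (x ^ 2 - 1) →
      x ^ 2 + x * u + u ^ 2 - 4 - c * (x + u) = 0 := fun x hxu hx =>
    mul_left_cancel₀ (sub_ne_zero.2 hxu) (by linear_combination hx - hu)
  have lin : ∀ x : ℝ, x ≠ u → x ≠ v → x ^ 3 - 4 * x = c * (x ^ 2 - 1) →
      x + u + v - c = 0 := fun x hxu hxv hx =>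
    mul_left_cancel₀ (sub_ne_zero.2 hxv)
      (by linear_combination quad x hxu hx - quad v huv.symm hv)
  by_contra! h
  exact h.2.2 (by linear_combination lin z h.1 h.2.1 hz - lin w huw.symm hvw.symm hw)

/-- For every real number `c`, the equation
`z³ - 4z = c (z² - 1)` has exactly three real solutions, and no solution
satisfies `z² = 1`. (Hence `z ↦ (z³ - 4z)/(z² - 1)` is three-to-one over every
finite real value.) -/
theorem three_to_one_over_reals (c : ℝ) :
    {z : ℝ | z ^ 3 - 4 * z = c * (z ^ 2 - 1)}.ncard = 3 ∧
    ∀ z : ℝ, z ^ 3 - 4 * z = c * (z ^ 2 - 1) → z ^ 2 ≠ 1 := by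
  constructor
  · let p : ℝ → ℝ := fun z => z ^ 3 - 4 * z - c * (z ^ 2 - 1)
    have hp : Continuous p := by fun_prop
    have hc := abs_nonneg c
    have hc₁ := le_abs_self c
    have hc₂ := neg_abs_le c
    set M := |c| + 3 with hM
    have hMc : 0 < M ^ 2 - 1 := by nlinarith
    have hpM : 0 < p M := by
      simp only [p]
      nlinarith [mul_nonneg (sub_nonneg.2 hc₁) hMc.le]
    have hpM' : p (-M) < 0 := by
      simp only [p]
      nlinarith [mul_nonneg (neg_le_iff_add_nonneg.1 hc₂) hMc.le]
    obtain ⟨u, ⟨-, hu₁⟩, hu⟩ := intermediate_value_Ioo (by linarith : -M ≤ -1)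
      hp.continuousOn (show (0 : ℝ) ∈ Set.Ioo (p (-M)) (p (-1)) from ⟨hpM', by norm_num [p]⟩)
    obtain ⟨v, ⟨hv₁, hv₂⟩, hv⟩ := intermediate_value_Ioo' (by norm_num : (-1 : ℝ) ≤ 1)
      hp.continuousOn
      (show (0 : ℝ) ∈ Set.Ioo (p 1) (p (-1)) from ⟨by norm_num [p], by norm_num [p]⟩)
    obtain ⟨w, ⟨hw₁, -⟩, hw⟩ := intermediate_value_Ioo (by linarith : 1 ≤ M)
      hp.continuousOn (show (0 : ℝ) ∈ Set.Ioo (p 1) (p M) from ⟨by norm_num [p], hpM⟩)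
    have huv : u ≠ v := (hu₁.trans hv₁).ne
    have hvw : v ≠ w := (hv₂.trans hw₁).ne
    have huw : u ≠ w := ((hu₁.trans hv₁).trans (hv₂.trans hw₁)).ne
    refine Set.ncard_eq_three.2 ⟨u, v, w, huv, huw, hvw, Set.ext fun z => ⟨fun hz => ?_, ?_⟩⟩
    · exact eq_or_eq_or_eq_of_solutions huv huw hvw (sub_eq_zero.1 hu) (sub_eq_zero.1 hv)
        (sub_eq_zero.1 hw) hz
    · rintro (rfl | rfl | rfl)
      exacts [sub_eq_zero.1 hu, sub_eq_zero.1 hv, sub_eq_zero.1 hw]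
  · intro z hz h
    have hz₀ : z = 0 := by linear_combination (-1 / 3) * hz + (z - c) / 3 * h
    norm_num [hz₀] at h
end
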